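/- (L^p characterization of dyadic BMO.) Let 0 < p < ∞ and let f ∈ S be such that (1/|I|)∫_I |f − [f]_I|^p ≤ A^p for all dyadic intervals I, for some A > 0. Then ‖f‖_{BMO} ≤ C(p)·A, where C(p) depends only on p. -/

import Mathlib

open MeasureTheory Set

noncomputable section

namespace Dyadic

/-- A dyadic interval/lacunary tile: `I = [j·2^k, (j+1)·2^k)` with `-M ≤ k ≤ M`,
`I ⊆ [0, 2^M)`.  Lacunary tiles are in bijection with dyadic intervals, so we
identify the tile `P⁺(I) = I × [1/|I|, 2/|I|)` with the data of `I`. -/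
structure Tile (M : ℕ) where
  j : ℤ
  k : ℤ
  hk_lb : -(M : ℤ) ≤ k
  hk_ub : k ≤ (M : ℤ)
  hj : 0 ≤ j
  hsub : ((j : ℝ) + 1) * 2 ^ k ≤ 2 ^ (M : ℤ)

variable {M : ℕ}

/-- The side length `|I_P| = 2^k` of the spatial interval of the tile. -/
def Tile.len (P : Tile M) : ℝ := 2 ^ P.k

/-- The spatial interval `I_P` of the tile. -/
def Tile.ival (P : Tile M) : Set ℝ :=
  Ico ((P.j : ℝ) * 2 ^ P.k) (((P.j : ℝ) + 1) * 2 ^ P.k)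

/-- The order `P ≤′ Q` on lacunary tiles: `I_P ⊆ I_Q`. -/
def Tile.le (P Q : Tile M) : Prop := P.ival ⊆ Q.ival

/-- A (lacunary) tree: a collection of tiles together with a top tile. -/
structure Tree (M : ℕ) where
  tiles : Set (Tile M)
  top : Tile M
  top_mem : top ∈ tiles
  le_top : ∀ P ∈ tiles, P.le top

/-- `|I_T|`, the length of the spatial interval of the top of the tree. -/
def Tree.len (T : Tree M) : ℝ := T.top.len

/-- A collection of tiles is convex if `P₁ ≤′ P ≤′ P₂` with `P₁, P₂` in the
collection implies `P` is in the collection. -/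
def IsConvex (PP : Set (Tile M)) : Prop :=
  ∀ P₁ ∈ PP, ∀ P₂ ∈ PP, ∀ P : Tile M, P₁.le P → P.le P₂ → P ∈ PP

/-- The size `‖a‖_{size(T)} = (1/|I_T|) Σ_{P ∈ T} a(P)` of `a` on a tree `T`. -/
def treeSize (a : Tile M → ℝ) (T : Tree M) : ℝ :=
  (∑ᶠ P ∈ T.tiles, a P) / T.len

/-- The maximal size `‖a‖_{size*(PP)}`: the supremum of `‖a‖_{size(T)}` over all
convex trees `T ⊆ PP` (by convention `0` if there are none). -/
def maxSize (a : Tile M → ℝ) (PP : Set (Tile M)) : ℝ :=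
  sSup (insert 0 {s : ℝ | ∃ T : Tree M, T.tiles ⊆ PP ∧ IsConvex T.tiles ∧ s = treeSize a T})

/-- The complete tree `Tree(P) = {Q : Q ≤′ P}`. -/
def cTree (P : Tile M) : Set (Tile M) := {Q : Tile M | Q.le P}

/-- A tree `T` is complete with respect to `PP` if `T = Tree(P_T) ∩ PP`. -/
def Tree.IsCompleteIn (T : Tree M) (PP : Set (Tile M)) : Prop :=
  T.tiles = cTree T.top ∩ PP

/-- `QQ` is an `α`-packing of the tree `T`: `QQ ⊆ T` and `Σ_{P ∈ QQ} |I_P| ≤ α|I_T|`. -/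
def IsPacking (α : ℝ) (QQ : Set (Tile M)) (T : Tree M) : Prop :=
  QQ ⊆ T.tiles ∧ (∑ᶠ P ∈ QQ, Tile.len P) ≤ α * T.len

/-- `QQ` is a uniform `α`-packing of the tree `T`:
`Σ_{P ∈ QQ, I_P ⊆ J} |I_P| ≤ α|J|` for every dyadic interval `J`. -/
def IsUniformPacking (α : ℝ) (QQ : Set (Tile M)) (T : Tree M) : Prop :=
  QQ ⊆ T.tiles ∧
    ∀ J : Tile M, (∑ᶠ P ∈ {P ∈ QQ | P.ival ⊆ J.ival}, Tile.len P) ≤ α * J.len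

/-- Left half of the spatial interval. -/
def Tile.left (P : Tile M) : Set ℝ :=
  Ico ((P.j : ℝ) * 2 ^ P.k) (((P.j : ℝ) + 1 / 2) * 2 ^ P.k)

/-- Right half of the spatial interval. -/
def Tile.right (P : Tile M) : Set ℝ :=
  Ico (((P.j : ℝ) + 1 / 2) * 2 ^ P.k) (((P.j : ℝ) + 1) * 2 ^ P.k)

/-- The (mother) Haar wavelet `φ_P = |I_P|^{-1/2}(χ_{I_l} - χ_{I_r})`. -/
def Tile.haar (P : Tile M) : ℝ → ℝ := fun x =>
  (Real.sqrt P.len)⁻¹ * (P.left.indicator 1 x - P.right.indicator 1 x)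

/-- The Haar (wavelet) coefficient `Wf(P) = ⟨f, φ_P⟩`. -/
def waveCoeff (f : ℝ → ℝ) (P : Tile M) : ℝ := ∫ x, f x * P.haar x

/-- The average `[f]_{I_P} = (1/|I_P|)∫_{I_P} f`. -/
def tileAvg (f : ℝ → ℝ) (P : Tile M) : ℝ := (∫ x in P.ival, f x) / P.len

/-- The mean `‖f‖_{mean(P)} = (1/|I_P|)∫_{I_P} |f|`. -/
def tileMean (f : ℝ → ℝ) (P : Tile M) : ℝ := (∫ x in P.ival, |f x|) / P.len

/-- The maximal mean `‖f‖_{mean*(PP)} = sup_{P ∈ PP} ‖f‖_{mean(P)}`. -/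
def maxMean (f : ℝ → ℝ) (PP : Set (Tile M)) : ℝ :=
  sSup (insert 0 (tileMean f '' PP))

/-- The dyadic BMO norm `‖f‖_{BMO} = ‖|Wf|²‖_{size*(PP⁺)}^{1/2}`. -/
def bmoNorm (M : ℕ) (f : ℝ → ℝ) : ℝ :=
  Real.sqrt (maxSize (fun P : Tile M => waveCoeff f P ^ 2) univ)

/-- The grid interval `[j·2^{-M}, (j+1)·2^{-M})` at the finest scale. -/
def gridIval (M : ℕ) (j : ℤ) : Set ℝ :=
  Ico ((j : ℝ) * 2 ^ (-(M : ℤ))) (((j : ℝ) + 1) * 2 ^ (-(M : ℤ)))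

/-- A dyadic test function: supported on `[0, 2^M)` and constant on every dyadic
interval of length `2^{-M}`. -/
def IsTestFun (M : ℕ) (f : ℝ → ℝ) : Prop :=
  (∀ x : ℝ, x ∉ Ico (0 : ℝ) (2 ^ (M : ℤ)) → f x = 0) ∧
    ∀ j : ℤ, ∀ x ∈ gridIval M j, ∀ y ∈ gridIval M j, f x = f y

/-- The `L²` norm. -/
def l2Norm (f : ℝ → ℝ) : ℝ := Real.sqrt (∫ x, f x ^ 2)

/-- The `L^∞` norm (as a supremum of values; adequate for test functions). -/
def supNorm (f : ℝ → ℝ) : ℝ := ⨆ x : ℝ, |f x|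

/-- The weak `L^r` quasinorm `sup_{λ>0} λ |{|h| ≥ λ}|^{1/r}`. -/
def weakNorm (r : ℝ) (h : ℝ → ℝ) : ℝ :=
  sSup {s : ℝ | ∃ l : ℝ, 0 < l ∧ s = l * (volume {x : ℝ | l ≤ |h x|}).toReal ^ (1 / r)}

/-- The phase space projection `Π_T f = Σ_{P ∈ T} ⟨f, φ_P⟩ φ_P` onto a tree. -/
def treeProj (T : Tree M) (f : ℝ → ℝ) : ℝ → ℝ := fun x =>
  ∑ᶠ P ∈ T.tiles, waveCoeff f P * P.haar x

/-- The high-low paraproduct `π_hl(f,g) = Σ_P Wf(P) [g]_P φ_P`. -/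
def paraHL (M : ℕ) (f g : ℝ → ℝ) : ℝ → ℝ := fun x =>
  ∑ᶠ P : Tile M, waveCoeff f P * tileAvg g P * P.haar x

/-- The low-high paraproduct `π_lh(f,g) = Σ_P [f]_P Wg(P) φ_P`. -/
def paraLH (M : ℕ) (f g : ℝ → ℝ) : ℝ → ℝ := fun x =>
  ∑ᶠ P : Tile M, tileAvg f P * waveCoeff g P * P.haar x

/-- The high-high paraproduct `π_hh(f,g) = Σ_P Wf(P) Wg(P) χ_{I_P}/|I_P|`. -/
def paraHH (M : ℕ) (f g : ℝ → ℝ) : ℝ → ℝ := fun x =>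
  ∑ᶠ P : Tile M, waveCoeff f P * waveCoeff g P * P.ival.indicator 1 x / P.len

/-- The constant function `1` on `[0, 2^M)`. -/
def oneFn (M : ℕ) : ℝ → ℝ := (Ico (0 : ℝ) (2 ^ (M : ℤ))).indicator 1

/-- A perfect dyadic Calderón–Zygmund operator, recorded via its kernel `K` and
kernel constant `A₀`. -/
structure PDCZ (M : ℕ) where
  K : ℝ → ℝ → ℝ
  A₀ : ℝ
  hA₀ : 0 < A₀
  meas : Measurable (Function.uncurry K)
  bound : ∀ x y : ℝ, x ≠ y → |K x y| ≤ A₀ / |x - y|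
  perfectX : ∀ I J : Tile M, Disjoint I.ival J.ival →
    ∀ x ∈ I.ival, ∀ x' ∈ I.ival, ∀ y ∈ J.ival, K x y = K x' y
  perfectY : ∀ I J : Tile M, Disjoint I.ival J.ival →
    ∀ x ∈ I.ival, ∀ x' ∈ I.ival, ∀ y ∈ J.ival, K y x = K y x'
  diag : ∀ I : Tile M, I.k = -(M : ℤ) → ∀ x ∈ I.ival, ∀ y ∈ I.ival, K x y = 0
  corner₁ : ∀ x ∈ Ico (0 : ℝ) (2 ^ ((M : ℤ) - 1)),
    ∀ y ∈ Ico ((2 : ℝ) ^ ((M : ℤ) - 1)) (2 ^ (M : ℤ)), K x y = 0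
  corner₂ : ∀ x ∈ Ico ((2 : ℝ) ^ ((M : ℤ) - 1)) (2 ^ (M : ℤ)),
    ∀ y ∈ Ico (0 : ℝ) (2 ^ ((M : ℤ) - 1)), K x y = 0

/-- `Tf(x) = ∫ K(x,y) f(y) dy`. -/
def PDCZ.app (Op : PDCZ M) (f : ℝ → ℝ) : ℝ → ℝ := fun x => ∫ y, Op.K x y * f y

/-- The transpose `T*f(x) = ∫ K(y,x) f(y) dy`. -/
def PDCZ.appT (Op : PDCZ M) (f : ℝ → ℝ) : ℝ → ℝ := fun x => ∫ y, Op.K y x * f y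

/-- Complex-valued Haar coefficient. -/
def waveCoeffC (b : ℝ → ℂ) (P : Tile M) : ℂ := ∫ x, b x * (P.haar x : ℂ)

/-- Complex-valued average. -/
def tileAvgC (b : ℝ → ℂ) (P : Tile M) : ℂ := (∫ x in P.ival, b x) / (P.len : ℂ)

/-- BMO norm of a complex-valued function. -/
def bmoNormC (M : ℕ) (b : ℝ → ℂ) : ℝ :=
  Real.sqrt (maxSize (fun P : Tile M => ‖waveCoeffC b P‖ ^ 2) univ)

/-- Complex-valued dyadic test functions. -/
def IsTestFunC (M : ℕ) (b : ℝ → ℂ) : Prop :=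
  (∀ x : ℝ, x ∉ Ico (0 : ℝ) (2 ^ (M : ℤ)) → b x = 0) ∧
    ∀ j : ℤ, ∀ x ∈ gridIval M j, ∀ y ∈ gridIval M j, b x = b y

/-- The operator applied to a complex-valued function. -/
def PDCZ.appC (Op : PDCZ M) (b : ℝ → ℂ) : ℝ → ℂ := fun x => ∫ y, (Op.K x y : ℂ) * b y


theorem Tile.len_pos (P : Tile M) : 0 < P.len := by
  unfold Tile.len; positivity

theorem Tile.eq_of {P Q : Tile M} (h1 : P.j = Q.j) (h2 : P.k = Q.k) : P = Q := by
  cases P; cases Q; simp only at h1 h2; subst h1; subst h2; rfl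

/-- left child -/
def Tile.lc (P : Tile M) (h : -(M : ℤ) < P.k) : Tile M where
  j := 2 * P.j
  k := P.k - 1
  hk_lb := by omega
  hk_ub := by have := P.hk_ub; omega
  hj := by have := P.hj; omega
  hsub := by
    have h1 := P.hsub
    have h2 : (2:ℝ) ^ P.k = 2 ^ (P.k - 1) * 2 := by
      rw [← zpow_add_one₀ (by norm_num)]; congr 1; ring
    have h3 : (0:ℝ) < 2 ^ (P.k - 1) := by positivity
    rw [h2] at h1
    push_cast
    nlinarith

/-- right child -/
def Tile.rc (P : Tile M) (h : -(M : ℤ) < P.k) : Tile M where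
  j := 2 * P.j + 1
  k := P.k - 1
  hk_lb := by omega
  hk_ub := by have := P.hk_ub; omega
  hj := by have := P.hj; omega
  hsub := by
    have h1 := P.hsub
    have h2 : (2:ℝ) ^ P.k = 2 ^ (P.k - 1) * 2 := by
      rw [← zpow_add_one₀ (by norm_num)]; congr 1; ring
    have h3 : (0:ℝ) < 2 ^ (P.k - 1) := by positivity
    rw [h2] at h1
    push_cast
    nlinarith

theorem two_zpow_pred (k : ℤ) : (2:ℝ) ^ k = 2 ^ (k - 1) * 2 := by
  rw [← zpow_add_one₀ (by norm_num)]; congr 1; ring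

theorem Tile.lc_ival (P : Tile M) (h) : (P.lc h).ival = P.left := by
  simp only [Tile.ival, Tile.left, Tile.lc]
  rw [two_zpow_pred P.k]; push_cast; congr 1 <;> ring

theorem Tile.rc_ival (P : Tile M) (h) : (P.rc h).ival = P.right := by
  simp only [Tile.ival, Tile.right, Tile.rc]
  rw [two_zpow_pred P.k]; push_cast; congr 1 <;> ring

theorem Tile.lc_len (P : Tile M) (h) : (P.lc h).len = P.len / 2 := by
  simp only [Tile.len, Tile.lc]
  rw [two_zpow_pred P.k]; ring

theorem Tile.rc_len (P : Tile M) (h) : (P.rc h).len = P.len / 2 := by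
  simp only [Tile.len, Tile.rc]
  rw [two_zpow_pred P.k]; ring

theorem Tile.left_union_right (P : Tile M) : P.left ∪ P.right = P.ival := by
  have : (0:ℝ) < 2 ^ P.k := by positivity
  unfold Tile.left Tile.right Tile.ival
  exact Ico_union_Ico_eq_Ico (by nlinarith) (by nlinarith)

theorem Tile.left_disj_right (P : Tile M) : Disjoint P.left P.right := by
  unfold Tile.left Tile.right
  exact Ico_disjoint_Ico_same

theorem Tile.vol (P : Tile M) : volume.real P.ival = P.len := by
  have h : (0:ℝ) < 2 ^ P.k := by positivity
  unfold Tile.ival Tile.len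
  rw [Real.volume_real_Ico_of_le (by nlinarith)]; ring

theorem Tile.le_cases {P J : Tile M} (h : P.le J) :
    P = J ∨ (P.k < J.k ∧ (P.ival ⊆ J.left ∨ P.ival ⊆ J.right)) := by
  have hp : (0:ℝ) < 2 ^ P.k := by positivity
  have hj : (0:ℝ) < 2 ^ J.k := by positivity
  unfold Tile.le at h
  have h' := h
  unfold Tile.ival at h'
  rw [Ico_subset_Ico_iff (by nlinarith)] at h'
  obtain ⟨h1, h2⟩ := h'
  have hle : (2:ℝ) ^ P.k ≤ 2 ^ J.k := by nlinarith
  have hk : P.k ≤ J.k := (zpow_le_zpow_iff_right₀ (by norm_num)).1 hle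
  rcases hk.eq_or_lt with hk | hk
  · left
    rw [hk] at h1 h2
    have a1 : (J.j : ℝ) ≤ P.j := le_of_mul_le_mul_right h1 hj
    have a2 : (P.j : ℝ) + 1 ≤ J.j + 1 := le_of_mul_le_mul_right h2 hj
    have a1' : J.j ≤ P.j := by exact_mod_cast a1
    have a2' : P.j + 1 ≤ J.j + 1 := by exact_mod_cast a2
    exact Tile.eq_of (by omega) hk
  · right
    refine ⟨hk, ?_⟩
    obtain ⟨n, hn⟩ : ∃ n : ℕ, J.k = P.k + n + 1 := ⟨(J.k - P.k - 1).toNat, by omega⟩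
    have hz : (2:ℝ) ^ J.k = 2 ^ P.k * 2 ^ n * 2 := by
      rw [hn, zpow_add_one₀ (by norm_num), zpow_add₀ (by norm_num), zpow_natCast]
    unfold Tile.left Tile.right Tile.ival
    rw [Ico_subset_Ico_iff (by nlinarith), Ico_subset_Ico_iff (by nlinarith)]
    rcases lt_or_ge P.j ((2 * J.j + 1) * 2 ^ n) with hc | hc
    · left
      refine ⟨h1, ?_⟩
      have : P.j + 1 ≤ (2 * J.j + 1) * 2 ^ n := hc
      have : (P.j : ℝ) + 1 ≤ (2 * J.j + 1) * 2 ^ n := by exact_mod_cast this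
      rw [hz]
      nlinarith [mul_le_mul_of_nonneg_right this hp.le]
    · right
      refine ⟨?_, h2⟩
      have : (2 * J.j + 1) * 2 ^ n ≤ (P.j : ℝ) := by exact_mod_cast hc
      rw [hz]
      nlinarith [mul_le_mul_of_nonneg_right this hp.le]

theorem IsTestFun.eq_floor {f : ℝ → ℝ} (hf : IsTestFun M f) (x : ℝ) :
    f x = f ((⌊x * 2 ^ (M : ℤ)⌋ : ℝ) * 2 ^ (-(M : ℤ))) := by
  have hM : (0:ℝ) < 2 ^ (-(M : ℤ)) := by positivity
  have hx : x = x * 2 ^ (M : ℤ) * 2 ^ (-(M : ℤ)) := by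
    rw [_root_.mul_assoc, ← zpow_add₀ (by norm_num)]; simp
  refine hf.2 ⌊x * 2 ^ (M : ℤ)⌋ _ ?_ _ ?_
  · constructor
    · conv_rhs => rw [hx]
      exact mul_le_mul_of_nonneg_right (Int.floor_le _) hM.le
    · conv_lhs => rw [hx]
      exact mul_lt_mul_of_pos_right (Int.lt_floor_add_one _) hM
  · constructor
    · exact le_rfl
    · nlinarith

theorem IsTestFun.meas {f : ℝ → ℝ} (hf : IsTestFun M f) : Measurable f := by
  have : f = (fun n : ℤ => f ((n : ℝ) * 2 ^ (-(M : ℤ)))) ∘ fun x => ⌊x * 2 ^ (M : ℤ)⌋ := by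
    funext x; exact hf.eq_floor x
  rw [this]
  exact (measurable_from_top).comp (Int.measurable_floor.comp (measurable_id.mul_const _))

theorem IsTestFun.bdd {f : ℝ → ℝ} (hf : IsTestFun M f) : ∃ B, ∀ x, |f x| ≤ B := by
  refine ⟨∑ n ∈ Finset.Icc (0:ℤ) ⌊(2:ℝ) ^ (M : ℤ) * 2 ^ (M : ℤ)⌋,
    |f ((n : ℝ) * 2 ^ (-(M : ℤ)))|, fun x => ?_⟩
  by_cases hx : x ∈ Ico (0 : ℝ) (2 ^ (M : ℤ))
  · rw [hf.eq_floor x]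
    have hM : (0:ℝ) < 2 ^ (M : ℤ) := by positivity
    refine Finset.single_le_sum (f := fun n : ℤ => |f ((n : ℝ) * 2 ^ (-(M : ℤ)))|)
      (fun i _ => abs_nonneg _) (Finset.mem_Icc.2 ⟨?_, ?_⟩)
    · exact Int.floor_nonneg.2 (mul_nonneg hx.1 hM.le)
    · exact Int.floor_le_floor (mul_le_mul_of_nonneg_right hx.2.le hM.le)
  · rw [hf.1 x hx, abs_zero]
    exact Finset.sum_nonneg fun i _ => abs_nonneg _

theorem IsTestFun.integrableOn {f : ℝ → ℝ} (hf : IsTestFun M f) (a b : ℝ) :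
    IntegrableOn f (Ico a b) := by
  obtain ⟨B, hB⟩ := hf.bdd
  exact Measure.integrableOn_of_bounded (M := B) (by simp) hf.meas.aestronglyMeasurable
    (Filter.Eventually.of_forall hB)

theorem IsTestFun.integrableOn_pow {f : ℝ → ℝ} (hf : IsTestFun M f) (a b c p : ℝ) (hp : 0 < p) :
    IntegrableOn (fun x => |f x - c| ^ p) (Ico a b) := by
  obtain ⟨B, hB⟩ := hf.bdd
  refine Measure.integrableOn_of_bounded (M := (B + |c|) ^ p) (by simp)
    ((hf.meas.sub_const c).abs.pow_const p).aestronglyMeasurable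
    (Filter.Eventually.of_forall fun x => ?_)
  rw [Real.norm_of_nonneg (by positivity)]
  refine Real.rpow_le_rpow (abs_nonneg _) ?_ hp.le
  exact (abs_sub _ _).trans (by linarith [hB x])

theorem waveCoeff_eq {f : ℝ → ℝ} (hf : IsTestFun M f) (P : Tile M) :
    waveCoeff f P = (Real.sqrt P.len)⁻¹ * ((∫ x in P.left, f x) - ∫ x in P.right, f x) := by
  unfold waveCoeff Tile.haar
  have hl : MeasurableSet P.left := measurableSet_Ico
  have hr : MeasurableSet P.right := measurableSet_Ico
  rw [← integral_indicator hl, ← integral_indicator hr, ← integral_sub, ← integral_const_mul]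
  · congr 1; funext x
    by_cases h1 : x ∈ P.left <;> by_cases h2 : x ∈ P.right <;> simp [h1, h2] <;> ring
  · exact (integrable_indicator_iff hl).2 (hf.integrableOn _ _)
  · exact (integrable_indicator_iff hr).2 (hf.integrableOn _ _)

theorem waveCoeff_sq {f : ℝ → ℝ} (hf : IsTestFun M f) (P : Tile M) (h) :
    waveCoeff f P ^ 2 = P.len * (tileAvg f (P.lc h) - tileAvg f (P.rc h)) ^ 2 / 4 := by
  have hP := P.len_pos
  rw [waveCoeff_eq hf, tileAvg, tileAvg, Tile.lc_ival, Tile.rc_ival, Tile.lc_len, Tile.rc_len,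
    mul_pow, inv_pow, Real.sq_sqrt hP.le]
  field_simp
  ring

theorem tileAvg_split {f : ℝ → ℝ} (hf : IsTestFun M f) (P : Tile M) (h) :
    tileAvg f P = (tileAvg f (P.lc h) + tileAvg f (P.rc h)) / 2 := by
  have hP := P.len_pos
  rw [tileAvg, tileAvg, tileAvg, Tile.lc_ival, Tile.rc_ival, Tile.lc_len, Tile.rc_len,
    ← P.left_union_right, setIntegral_union P.left_disj_right measurableSet_Ico
      (hf.integrableOn _ _) (hf.integrableOn _ _)]
  field_simp

theorem waveCoeff_fine {f : ℝ → ℝ} (hf : IsTestFun M f) (P : Tile M) (h : P.k = -(M : ℤ)) :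
    waveCoeff f P = 0 := by
  have hk : (0:ℝ) < 2 ^ P.k := by positivity
  have hc : ∀ x ∈ P.ival, f x = f ((P.j : ℝ) * 2 ^ P.k) := by
    intro x hx
    refine hf.2 P.j x ?_ _ ?_
    · unfold gridIval; rw [← h]; exact hx
    · unfold gridIval; rw [← h]; constructor
      · exact le_rfl
      · nlinarith
  have hu := P.left_union_right
  rw [waveCoeff_eq hf,
    setIntegral_congr_fun (g := fun _ => f ((P.j : ℝ) * 2 ^ P.k)) (s := P.left) measurableSet_Ico
      (fun x hx => hc x (hu ▸ Or.inl hx)),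
    setIntegral_congr_fun (g := fun _ => f ((P.j : ℝ) * 2 ^ P.k)) (s := P.right) measurableSet_Ico
      (fun x hx => hc x (hu ▸ Or.inr hx))]
  rw [setIntegral_const, setIntegral_const]
  have h1 : volume.real P.left = 2 ^ P.k / 2 := by
    unfold Tile.left; rw [Real.volume_real_Ico_of_le (by nlinarith)]; ring
  have h2 : volume.real P.right = 2 ^ P.k / 2 := by
    unfold Tile.right; rw [Real.volume_real_Ico_of_le (by nlinarith)]; ring
  rw [h1, h2]; simp

/-- exceptional measure -/
def excM (f : ℝ → ℝ) (l c : ℝ) (s : Set ℝ) : ℝ := volume.real (s ∩ {x | l ≤ |f x - c|})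

theorem Tile.fin (P : Tile M) : volume P.ival ≠ ⊤ := by
  unfold Tile.ival; simp

theorem excM_mono (f : ℝ → ℝ) (l c : ℝ) {P J : Tile M} (h : P.ival ⊆ J.ival) :
    excM f l c P.ival ≤ excM f l c J.ival := by
  unfold excM
  exact measureReal_mono (inter_subset_inter_left _ h)
    (measure_ne_top_of_subset inter_subset_left J.fin)

theorem excM_split {f : ℝ → ℝ} (hf : IsTestFun M f) (l c : ℝ) (J : Tile M) (h) :
    excM f l c J.ival = excM f l c (J.lc h).ival + excM f l c (J.rc h).ival := by
  unfold excM
  have hms : MeasurableSet {x | l ≤ |f x - c|} :=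
    measurableSet_le measurable_const (hf.meas.sub_const c).abs
  rw [← J.left_union_right, union_inter_distrib_right, measureReal_union
    (J.left_disj_right.mono inter_subset_left inter_subset_left) (measurableSet_Ico.inter hms)
    (measure_ne_top_of_subset inter_subset_left (by unfold Tile.left; simp))
    (measure_ne_top_of_subset inter_subset_left (by unfold Tile.right; simp))]
  rw [Tile.lc_ival, Tile.rc_ival]

theorem excM_cover (f : ℝ → ℝ) (l c d : ℝ) (J : Tile M) (h : 2 * l < |d - c|) :
    J.len ≤ excM f l c J.ival + excM f l d J.ival := by
  rw [← J.vol]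
  unfold excM
  refine (measureReal_mono ?_ ?_).trans (measureReal_union_le _ _)
  · intro x hx
    by_contra hn
    simp only [mem_union, mem_inter_iff, hx, true_and, mem_ofPred_eq, not_or, not_le] at hn
    have := abs_sub_le d (f x) c
    rw [abs_sub_comm d (f x)] at this
    linarith [hn.1, hn.2]
  · rw [← inter_union_distrib_left]
    exact measure_ne_top_of_subset inter_subset_left J.fin

theorem key {f : ℝ → ℝ} (hf : IsTestFun M f) (l : ℝ) (hl : 0 < l)
    (H : ∀ J : Tile M, excM f l (tileAvg f J) J.ival ≤ J.len / 8) (n : ℕ) :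
    ∀ J : Tile M, J.k = -(M : ℤ) + n → ∀ c, |tileAvg f J - c| ≤ 4 * l →
      ∀ s : Finset (Tile M), (∀ P ∈ s, P.le J) →
      (∑ P ∈ s, waveCoeff f P ^ 2) + J.len * (tileAvg f J - c) ^ 2 ≤
        4 * l ^ 2 * J.len + 28 * l ^ 2 * excM f l c J.ival := by
  classical
  have stepB : ∀ J : Tile M, (∀ c, |tileAvg f J - c| ≤ 2 * l →
      ∀ s : Finset (Tile M), (∀ P ∈ s, P.le J) →
      (∑ P ∈ s, waveCoeff f P ^ 2) + J.len * (tileAvg f J - c) ^ 2 ≤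
        4 * l ^ 2 * J.len + 28 * l ^ 2 * excM f l c J.ival) →
      ∀ c, |tileAvg f J - c| ≤ 4 * l →
      ∀ s : Finset (Tile M), (∀ P ∈ s, P.le J) →
      (∑ P ∈ s, waveCoeff f P ^ 2) + J.len * (tileAvg f J - c) ^ 2 ≤
        4 * l ^ 2 * J.len + 28 * l ^ 2 * excM f l c J.ival := by
    intro J hA c hc s hs
    rcases le_or_gt (|tileAvg f J - c|) (2 * l) with h2 | h2
    · exact hA c h2 s hs
    have h1 := hA (tileAvg f J) (by simp; positivity) s hs
    simp only [sub_self] at h1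
    have h3 := excM_cover f l c (tileAvg f J) J h2
    have h4 := H J
    have h5 : (tileAvg f J - c) ^ 2 ≤ 16 * l ^ 2 := by
      rw [← sq_abs]; nlinarith [abs_nonneg (tileAvg f J - c)]
    have hJ := J.len_pos
    have h6 := mul_le_mul_of_nonneg_left h5 hJ.le
    have h7 : l ^ 2 * (7 / 8 * J.len) ≤ l ^ 2 * excM f l c J.ival :=
      mul_le_mul_of_nonneg_left (by linarith) (by positivity)
    have h8 := mul_le_mul_of_nonneg_left h4 (sq_nonneg l)
    have h9 : 0 < l ^ 2 * J.len := by positivity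
    nlinarith
  induction n with
  | zero =>
    intro J hJk
    refine stepB J fun c hc s hs => ?_
    have hz : ∑ P ∈ s, waveCoeff f P ^ 2 = 0 := by
      refine Finset.sum_eq_zero fun P hP => ?_
      rcases Tile.le_cases (hs P hP) with h | h
      · rw [h, waveCoeff_fine hf J (by simpa using hJk)]; simp
      · have := P.hk_lb
        simp at hJk; omega
    have h5 : (tileAvg f J - c) ^ 2 ≤ 4 * l ^ 2 := by
      rw [← sq_abs]; nlinarith [abs_nonneg (tileAvg f J - c)]
    have h6 := mul_le_mul_of_nonneg_left h5 J.len_pos.le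
    have h7 : 0 ≤ excM f l c J.ival := measureReal_nonneg
    have h8 : 0 ≤ 28 * l ^ 2 * excM f l c J.ival := by positivity
    rw [hz]; linarith
  | succ n ih =>
    intro J hJk
    refine stepB J fun c hc s hs => ?_
    have hk : -(M : ℤ) < J.k := by push_cast at hJk; omega
    have hJ := J.len_pos
    have close : ∀ Q : Tile M, Q.ival ⊆ J.ival → Q.len = J.len / 2 →
        |tileAvg f Q - tileAvg f J| ≤ 2 * l := by
      intro Q hQ hQl
      by_contra hn
      have h1 := excM_cover f l _ _ Q (not_le.1 hn)
      have h2 := H Q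
      have h3 := excM_mono f l (tileAvg f J) hQ
      have h4 := H J
      linarith
    have hsl : (J.lc hk).ival ⊆ J.ival := by
      rw [Tile.lc_ival, ← J.left_union_right]; exact subset_union_left
    have hsr : (J.rc hk).ival ⊆ J.ival := by
      rw [Tile.rc_ival, ← J.left_union_right]; exact subset_union_right
    have cl := close _ hsl (J.lc_len hk)
    have cr := close _ hsr (J.rc_len hk)
    have hL := ih (J.lc hk) (by simp only [Tile.lc]; push_cast at hJk; omega) c
      ((abs_sub_le _ (tileAvg f J) _).trans (by linarith))
      (s.filter fun P => P.ival ⊆ J.left)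
      (fun P hP => by rw [Tile.le, Tile.lc_ival]; exact (Finset.mem_filter.1 hP).2)
    have hR := ih (J.rc hk) (by simp only [Tile.rc]; push_cast at hJk; omega) c
      ((abs_sub_le _ (tileAvg f J) _).trans (by linarith))
      (s.filter fun P => P.ival ⊆ J.right)
      (fun P hP => by rw [Tile.le, Tile.rc_ival]; exact (Finset.mem_filter.1 hP).2)
    have hsum : ∑ P ∈ s, waveCoeff f P ^ 2 ≤ waveCoeff f J ^ 2 +
        (∑ P ∈ s.filter (fun P => P.ival ⊆ J.left), waveCoeff f P ^ 2 +
        ∑ P ∈ s.filter (fun P => P.ival ⊆ J.right), waveCoeff f P ^ 2) := by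
      have hsub : s ⊆ {J} ∪ (s.filter (fun P => P.ival ⊆ J.left) ∪
          s.filter (fun P => P.ival ⊆ J.right)) := by
        intro P hP
        simp only [Finset.mem_union, Finset.mem_singleton, Finset.mem_filter, hP, true_and]
        rcases Tile.le_cases (hs P hP) with h | h
        · exact Or.inl h
        · exact Or.inr h.2
      have hun : ∀ a b : Finset (Tile M), ∑ P ∈ a ∪ b, waveCoeff f P ^ 2 ≤
          ∑ P ∈ a, waveCoeff f P ^ 2 + ∑ P ∈ b, waveCoeff f P ^ 2 := by
        intro a b
        rw [← Finset.sum_union_inter]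
        have : 0 ≤ ∑ P ∈ a ∩ b, waveCoeff f P ^ 2 := Finset.sum_nonneg fun _ _ => sq_nonneg _
        linarith
      have h1 := Finset.sum_le_sum_of_subset_of_nonneg (f := fun P => waveCoeff f P ^ 2) hsub
        (fun _ _ _ => sq_nonneg _)
      have h2 := hun {J} (s.filter (fun P => P.ival ⊆ J.left) ∪
          s.filter (fun P => P.ival ⊆ J.right))
      have h3 := hun (s.filter (fun P => P.ival ⊆ J.left)) (s.filter (fun P => P.ival ⊆ J.right))
      rw [Finset.sum_singleton] at h2
      linarith
    rw [waveCoeff_sq hf J hk] at hsum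
    rw [excM_split hf l c J hk, tileAvg_split hf J hk]
    rw [Tile.lc_len] at hL
    rw [Tile.rc_len] at hR
    generalize tileAvg f (J.lc hk) = a at *
    generalize tileAvg f (J.rc hk) = b at *
    have : J.len * (a - b) ^ 2 / 4 + J.len * ((a + b) / 2 - c) ^ 2 =
      J.len / 2 * (a - c) ^ 2 + J.len / 2 * (b - c) ^ 2 := by ring
    linarith

theorem cheb {f : ℝ → ℝ} (hf : IsTestFun M f) (p A : ℝ) (hp : 0 < p) (hA : 0 < A) (J : Tile M)
    (h : (∫ x in J.ival, |f x - tileAvg f J| ^ p) ≤ A ^ p * J.len) :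
    excM f (8 ^ (1 / p) * A) (tileAvg f J) J.ival ≤ J.len / 8 := by
  have hK : (((8:ℝ) ^ (1 / p) * A) ^ p) = 8 * A ^ p := by
    rw [Real.mul_rpow (by positivity) hA.le, ← Real.rpow_mul (by norm_num)]
    rw [one_div_mul_cancel hp.ne', Real.rpow_one]
  have h1 := mul_meas_ge_le_integral_of_nonneg
    (μ := volume.restrict J.ival) (f := fun x => |f x - tileAvg f J| ^ p)
    (Filter.Eventually.of_forall fun x => by simp only [Pi.zero_apply]; positivity)
    (hf.integrableOn_pow _ _ _ p hp) (8 * A ^ p)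
  have hset : {x | 8 * A ^ p ≤ |f x - tileAvg f J| ^ p} =
      {x | 8 ^ (1 / p) * A ≤ |f x - tileAvg f J|} := by
    ext x
    simp only [mem_ofPred_eq]
    rw [← hK, Real.rpow_le_rpow_iff (by positivity) (abs_nonneg _) hp]
  have hms : MeasurableSet {x | 8 ^ (1 / p) * A ≤ |f x - tileAvg f J|} :=
    measurableSet_le measurable_const (hf.meas.sub_const _).abs
  rw [hset, measureReal_restrict_apply hms, inter_comm] at h1
  have h2 := h1.trans h
  have hAp : 0 < A ^ p := by positivity
  unfold excM
  have : A ^ p * (8 * volume.real (J.ival ∩ {x | 8 ^ (1 / p) * A ≤ |f x - tileAvg f J|})) ≤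
    A ^ p * J.len := by linarith
  have := le_of_mul_le_mul_left this hAp
  linarith

/-- L^p characterization of dyadic BMO. -/
theorem statement3 (p : ℝ) (hp : 0 < p) :
    ∃ C : ℝ, 0 < C ∧
      ∀ (M : ℕ) (f : ℝ → ℝ) (A : ℝ), 0 < A → IsTestFun M f →
        (∀ I : Tile M, (∫ x in I.ival, |f x - tileAvg f I| ^ p) ≤ A ^ p * I.len) →
        bmoNorm M f ≤ C * A := by
  refine ⟨3 * 8 ^ (1 / p), by positivity, ?_⟩
  intro M f A hA hf H
  set l : ℝ := 8 ^ (1 / p) * A with hl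
  have hl0 : 0 < l := by positivity
  have hH := fun J => cheb hf p A hp hA J (H J)
  rw [_root_.mul_assoc, ← hl]
  unfold bmoNorm
  refine Real.sqrt_le_iff.2 ⟨by positivity, ?_⟩
  unfold maxSize
  refine csSup_le (insert_nonempty _ _) ?_
  rintro s (rfl | ⟨T, -, -, rfl⟩)
  · positivity
  unfold treeSize Tree.len
  rw [div_le_iff₀ T.top.len_pos]
  have hpos := T.top.len_pos
  by_cases hfin : (T.tiles ∩ Function.support fun P : Tile M => waveCoeff f P ^ 2).Finite
  · rw [finsum_mem_eq_sum _ hfin]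
    have h1 := key hf l hl0 hH (T.top.k + M).toNat T.top
      (by have := T.top.hk_lb; omega) (tileAvg f T.top) (by simp; positivity) hfin.toFinset
      (fun P hP => T.le_top P ((hfin.mem_toFinset).1 hP).1)
    have h2 := mul_le_mul_of_nonneg_left (hH T.top) (sq_nonneg l)
    simp only [sub_self] at h1
    have h9 : 0 < l ^ 2 * T.top.len := by positivity
    nlinarith
  · rw [finsum_mem_eq_zero_of_infinite hfin]
    positivity

end Dyadic
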